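/- Let s be as in the context (any of the four cases). Then: (a) γ′ ∈ Δ_{s^{−1}}; (b) if α ∈ Δ_{s^{−1}} and α = η₁ + η₂ for some η₁, η₂ ∈ Δ_{s^{−1}}, then α = γ′; (c) if γ′ = η₁ + η₂ with η₁, η₂ ∈ Δ_{s^{−1}}, then one of η₁, η₂ lies in Δ^C and the other lies in Δ^R; (d) the ⟨s⟩-orbit O_{γ′} of γ′ in Δ satisfies O_{γ′} ∩ (Δ̄_K)₊ ⊆ Δ₃^O. -/

import Mathlib

/- Common framework: type A_l root system realized in ℝ^{ℕ} (coordinates 1,…,l+1 used),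
   the Weyl group as permutations of ℕ acting by permuting coordinates, and the
   Weyl group element s = s₁s₂ of Proposition 4.2 (all four parity cases). -/

noncomputable section

namespace DPW

/-- The ambient vector space (only coordinates 1,…,l+1 are used). -/
abbrev V : Type := ℕ → ℝ

/-- Standard basis vector e_i. -/
def evec (i : ℕ) : V := fun j => if j = i then 1 else 0

/-- The root e_i − e_j. -/
def rt (i j : ℕ) : V := evec i - evec j

/-- The root system Δ of type A_l. -/
def Delta (l : ℕ) : Set V :=
  {v | ∃ i j, 1 ≤ i ∧ i ≤ l + 1 ∧ 1 ≤ j ∧ j ≤ l + 1 ∧ i ≠ j ∧ v = rt i j}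

/-- Positive roots Δ₊. -/
def DeltaPos (l : ℕ) : Set V :=
  {v | ∃ i j, 1 ≤ i ∧ i < j ∧ j ≤ l + 1 ∧ v = rt i j}

/-- Negative roots Δ₋ = −Δ₊. -/
def DeltaNeg (l : ℕ) : Set V := {v | -v ∈ DeltaPos l}

/-- Action of a permutation on V : (σ·v)_j = v_{σ⁻¹(j)}. -/
def pact (σ : Equiv.Perm ℕ) (v : V) : V := fun j => v (σ⁻¹ j)

/-- row(e_a − e_b) = a. -/
def rowOf (v : V) : ℕ := sInf {a | v a = 1}

/-- col(e_a − e_b) = b. -/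
def colOf (v : V) : ℕ := sInf {b | v b = (-1 : ℝ)}

/-- Product of the simple reflections s_{α_i} = (i, i+1) for i in a list. -/
def swapProd (idxs : List ℕ) : Equiv.Perm ℕ :=
  (idxs.map (fun i => Equiv.swap i (i + 1))).prod

/-- The Weyl group element s = s₁s₂ (cases (i)–(iv) according to the parities of
    m = ⌊(l′−1)/2⌋ and l′; here p = l − l′ and s_γ = (m+1, m+p+2)). -/
def weylS (l l' : ℕ) : Equiv.Perm ℕ :=
  let m := (l' - 1) / 2
  let p := l - l'
  if m % 2 = 0 then
    if l' % 2 = 1 then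
      -- case (i)
      (swapProd (List.range' 2 (m / 2) 2) * swapProd (List.range' (m + p + 2) (m / 2) 2)) *
        (swapProd (List.range' 1 (m / 2) 2) * Equiv.swap (m + 1) (m + p + 2) *
          swapProd (List.range' (m + p + 3) (m / 2) 2))
    else
      -- case (ii)
      (swapProd (List.range' 2 (m / 2) 2) * swapProd (List.range' (m + p + 2) (m / 2 + 1) 2)) *
        (swapProd (List.range' 1 (m / 2) 2) * Equiv.swap (m + 1) (m + p + 2) *
          swapProd (List.range' (m + p + 3) (m / 2) 2))
  else
    if l' % 2 = 1 then
      -- case (iii)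
      (swapProd (List.range' 1 ((m + 1) / 2) 2) *
          swapProd (List.range' (m + p + 2) ((m + 1) / 2) 2)) *
        (swapProd (List.range' 2 ((m - 1) / 2) 2) * Equiv.swap (m + 1) (m + p + 2) *
          swapProd (List.range' (m + p + 3) ((m - 1) / 2) 2))
    else
      -- case (iv)
      (swapProd (List.range' 1 ((m + 1) / 2) 2) *
          swapProd (List.range' (m + p + 2) ((m + 1) / 2) 2)) *
        (swapProd (List.range' 2 ((m - 1) / 2) 2) * Equiv.swap (m + 1) (m + p + 2) *
          swapProd (List.range' (m + p + 3) ((m + 1) / 2) 2))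

/-- Δ_s = {α ∈ Δ₊ : sα ∈ Δ₋}. -/
def DeltaS (l : ℕ) (s : Equiv.Perm ℕ) : Set V :=
  {v ∈ DeltaPos l | pact s v ∈ DeltaNeg l}

/-- Δ_{s⁻¹} = {α ∈ Δ₊ : s⁻¹α ∈ Δ₋}. -/
def DeltaSinv (l : ℕ) (s : Equiv.Perm ℕ) : Set V :=
  {v ∈ DeltaPos l | pact s⁻¹ v ∈ DeltaNeg l}

/-- (Δ̄_K)₊ = {α ∈ Δ₊ : sα ≠ α}. -/
def DeltaKpos (l : ℕ) (s : Equiv.Perm ℕ) : Set V :=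
  {v ∈ DeltaPos l | pact s v ≠ v}

/-- (Δ̄_K)₋ = −(Δ̄_K)₊. -/
def DeltaKneg (l : ℕ) (s : Equiv.Perm ℕ) : Set V := {v | -v ∈ DeltaKpos l s}

/-- Δ^C = {α ∈ (Δ̄_K)₊ : row(sα) = row(α)}. -/
def DeltaC (l : ℕ) (s : Equiv.Perm ℕ) : Set V :=
  {v ∈ DeltaKpos l s | rowOf (pact s v) = rowOf v}

/-- Δ^R = {α ∈ (Δ̄_K)₊ : col(sα) = col(α)}. -/
def DeltaR (l : ℕ) (s : Equiv.Perm ℕ) : Set V :=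
  {v ∈ DeltaKpos l s | colOf (pact s v) = colOf v}

/-- Δ^O = (Δ̄_K)₊ \ (Δ^C ∪ Δ^R). -/
def DeltaO (l : ℕ) (s : Equiv.Perm ℕ) : Set V :=
  DeltaKpos l s \ (DeltaC l s ∪ DeltaR l s)

/-- Δ₁^O = {α ∈ Δ^O : row(α) ≥ m+p+2}. -/
def DeltaO1 (l : ℕ) (s : Equiv.Perm ℕ) (m p : ℕ) : Set V :=
  {v ∈ DeltaO l s | m + p + 2 ≤ rowOf v}

/-- Δ₂^O = {α ∈ Δ^O : col(α) ≤ m+1}. -/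
def DeltaO2 (l : ℕ) (s : Equiv.Perm ℕ) (m : ℕ) : Set V :=
  {v ∈ DeltaO l s | colOf v ≤ m + 1}

/-- Δ₃^O = Δ^O \ (Δ₁^O ∪ Δ₂^O). -/
def DeltaO3 (l : ℕ) (s : Equiv.Perm ℕ) (m p : ℕ) : Set V :=
  DeltaO l s \ (DeltaO1 l s m p ∪ DeltaO2 l s m)

/-- Δ̄_K^k = {α ∈ (Δ̄_K)₊ : s^{−j}α ∈ (Δ̄_K)₊ for 1 ≤ j ≤ k−1 and s^{−k}α ∈ (Δ̄_K)₋}. -/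
def DeltaKk (l : ℕ) (s : Equiv.Perm ℕ) (k : ℕ) : Set V :=
  {v ∈ DeltaKpos l s |
    (∀ j, 1 ≤ j → j ≤ k - 1 → pact (s⁻¹ ^ j) v ∈ DeltaKpos l s) ∧
      pact (s⁻¹ ^ k) v ∈ DeltaKneg l s}

/-- d(α) = min{k ≥ 1 : s^{−k}α ∈ Δ₋}. -/
def dd (l : ℕ) (s : Equiv.Perm ℕ) (v : V) : ℕ :=
  sInf {k | 1 ≤ k ∧ pact (s⁻¹ ^ k) v ∈ DeltaNeg l}

/-- Δ_Z = {e_i − e_j : m+2 ≤ i, j ≤ m+p+1, i ≠ j}. -/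
def DeltaZ (m p : ℕ) : Set V :=
  {v | ∃ i j, m + 2 ≤ i ∧ i ≤ m + p + 1 ∧ m + 2 ≤ j ∧ j ≤ m + p + 1 ∧ i ≠ j ∧ v = rt i j}

/-- The ⟨s⟩-orbit of a vector. -/
def orbitOf (s : Equiv.Perm ℕ) (v : V) : Set V := {w | ∃ n : ℤ, w = pact (s ^ n) v}

/-- The set P_κ (for κ ∈ Δ̄_K^k). -/
def Pk (l : ℕ) (s : Equiv.Perm ℕ) (k : ℕ) (κ : V) : Set (V × V) :=
  {q | (∃ i, 2 ≤ i ∧ i ≤ k - 1 ∧ q.1 ∈ DeltaKk l s i) ∧ q.2 ∈ DeltaKk l s k ∧ κ = q.1 + q.2}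

/-- The set P′_κ (for κ ∈ Δ̄_K^k). -/
def Pk' (l : ℕ) (s : Equiv.Perm ℕ) (k : ℕ) (κ : V) : Set (V × V) :=
  {q | q.1 ∈ DeltaKk l s k ∧ q.2 ∈ DeltaKk l s k ∧ κ = q.1 + q.2}

/-- The eigenvector v^λ of case (i) (m even, l′ = 2m+1 odd). -/
def vlam (m p : ℕ) (lam : ℂ) : ℕ → ℂ := fun j =>
  if j = 0 then 0
  else if j ≤ m + 1 then
    (if j % 2 = 1 then lam ^ ((4 * m + 5 - j) / 2) else lam ^ (j / 2))
  else if j ≤ m + p + 1 then 0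
  else if j ≤ m + p + m + 2 then
    (if (j - (m + p)) % 2 = 0 then lam ^ ((m + (j - (m + p))) / 2)
     else lam ^ ((3 * m + 5 - (j - (m + p))) / 2))
  else 0


/-- The permutation `weylS`, with `n = l + 1`, in closed form. -/
def weylFun (m p n x : ℕ) : ℕ :=
  if x = 0 ∨ n < x ∨ (m + 1 < x ∧ x < m + p + 2) then x
  else if x ≤ m + 1 then
    if x % 2 = m % 2 then (if x = 1 then 2 else if x = 2 then 1 else x - 2)
    else if x = m + 1 then m + p + 3 else x + 2
  else
    if (x - p) % 2 = m % 2 then (if x = m + p + 2 then m else x - 2)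
    else if x = n then n - 1 else if x + 1 = n then n else x + 2

/-- The inverse of `weylS`, with `n = l + 1`, in closed form. -/
def weylInvFun (m p n x : ℕ) : ℕ :=
  if x = 0 ∨ n < x ∨ (m + 1 < x ∧ x < m + p + 2) then x
  else if x ≤ m + 1 then
    if x % 2 = m % 2 then (if x = m then m + p + 2 else x + 2)
    else if x = 1 then 2 else if x = 2 then 1 else x - 2
  else
    if (x - p) % 2 = m % 2 then (if x = n then n - 1 else if x + 1 = n then n else x + 2)
    else if x = m + p + 3 then m + 1 else x - 2

/-- The first involution factor of `weylS` in closed form. -/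
def leftFun (m p n x : ℕ) : ℕ :=
  if 1 ≤ x ∧ x ≤ m + 1 then
    if x % 2 = m % 2 then x + 1 else if x = 1 then x else x - 1
  else if m + p + 2 ≤ x ∧ x ≤ n then
    if (x - p) % 2 = m % 2 then (if x = n then x else x + 1) else x - 1
  else x

/-- The second involution factor of `weylS` in closed form. -/
def rightFun (m p n x : ℕ) : ℕ :=
  if x = m + 1 then m + p + 2
  else if x = m + p + 2 then m + 1
  else if 1 ≤ x ∧ x ≤ m then
    if x % 2 = m % 2 then (if x = 1 then x else x - 1) else x + 1
  else if m + p + 3 ≤ x ∧ x ≤ n then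
    if (x - p) % 2 = m % 2 then x - 1 else if x = n then x else x + 1
  else x

theorem leftFun_rightFun {m p n : ℕ} (hm : 2 ≤ m)
    (hn : n = 2 * m + p + 2 ∨ n = 2 * m + p + 3) (x : ℕ) :
    leftFun m p n (rightFun m p n x) = weylFun m p n x := by
  unfold leftFun rightFun weylFun
  grind

theorem weylFun_weylInvFun {m p n : ℕ} (hm : 2 ≤ m)
    (hn : n = 2 * m + p + 2 ∨ n = 2 * m + p + 3) (x : ℕ) :
    weylFun m p n (weylInvFun m p n x) = x := by
  unfold weylFun weylInvFun
  grind

theorem swapProd_range'_apply (k a x : ℕ) :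
    swapProd (List.range' a k 2) x =
      if a ≤ x ∧ x < a + 2 * k then (if x % 2 = a % 2 then x + 1 else x - 1) else x := by
  induction k generalizing a with
  | zero => simp [swapProd]
  | succ k ih =>
    have h : swapProd (List.range' a (k + 1) 2) =
        Equiv.swap a (a + 1) * swapProd (List.range' (a + 2) k 2) := by
      simp [swapProd, List.range'_succ]
    rw [h, Equiv.Perm.mul_apply, ih, Equiv.swap_apply_def]
    grind

theorem weylS_apply {l l' m p : ℕ} (h5 : 5 ≤ l') (hll : l' ≤ l)
    (hm : m = (l' - 1) / 2) (hp : p = l - l') (x : ℕ) :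
    weylS l l' x = weylFun m p (l + 1) x := by
  have hm2 : 2 ≤ m := by omega
  rw [← leftFun_rightFun hm2 (by omega)]
  unfold weylS
  simp only [← hm, ← hp]
  have mul_apply_eq {σ τ : Equiv.Perm ℕ} {f g : ℕ → ℕ} (hσ : ∀ y, σ y = f y)
      (hτ : τ x = g x) : (σ * τ) x = f (g x) := by
    rw [Equiv.Perm.mul_apply, hτ, hσ]
  split_ifs with h1 h2 h2
  all_goals
    refine mul_apply_eq (fun y => ?_) ?_
    · simp only [Equiv.Perm.mul_apply, swapProd_range'_apply, leftFun]
      grind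
    · simp only [Equiv.Perm.mul_apply, swapProd_range'_apply, Equiv.swap_apply_def, rightFun]
      grind

theorem weylS_inv_apply {l l' m p : ℕ} (h5 : 5 ≤ l') (hll : l' ≤ l)
    (hm : m = (l' - 1) / 2) (hp : p = l - l') (x : ℕ) :
    (weylS l l')⁻¹ x = weylInvFun m p (l + 1) x := by
  rw [Equiv.Perm.inv_eq_iff_eq, weylS_apply h5 hll hm hp,
    weylFun_weylInvFun (by omega) (by omega)]

theorem rt_apply_eq_one {i j a : ℕ} (h : i ≠ j) : rt i j a = 1 ↔ a = i := by
  simp only [rt, evec, Pi.sub_apply]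
  split_ifs <;> simp_all
  norm_num

theorem rt_apply_eq_neg_one {i j a : ℕ} (h : i ≠ j) : rt i j a = -1 ↔ a = j := by
  simp only [rt, evec, Pi.sub_apply]
  split_ifs <;> simp_all
  norm_num

theorem rowOf_rt {i j : ℕ} (h : i ≠ j) : rowOf (rt i j) = i := by
  simp [rowOf, rt_apply_eq_one h]

theorem colOf_rt {i j : ℕ} (h : i ≠ j) : colOf (rt i j) = j := by
  simp [colOf, rt_apply_eq_neg_one h]

theorem rt_inj {i j a b : ℕ} (hij : i ≠ j) (hab : a ≠ b) :
    rt i j = rt a b ↔ i = a ∧ j = b := by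
  constructor
  · intro h
    exact ⟨by rw [← rowOf_rt hij, h, rowOf_rt hab], by rw [← colOf_rt hij, h, colOf_rt hab]⟩
  · rintro ⟨rfl, rfl⟩
    rfl

theorem neg_rt (i j : ℕ) : -rt i j = rt j i := by
  simp [rt]

theorem pact_rt (σ : Equiv.Perm ℕ) (i j : ℕ) : pact σ (rt i j) = rt (σ i) (σ j) := by
  funext a
  simp only [pact, rt, evec, Pi.sub_apply, Equiv.Perm.inv_eq_iff_eq]

theorem rt_mem_DeltaPos {l i j : ℕ} (h : i ≠ j) :
    rt i j ∈ DeltaPos l ↔ 1 ≤ i ∧ i < j ∧ j ≤ l + 1 := by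
  constructor
  · rintro ⟨a, b, ha, hab, hb, he⟩
    obtain ⟨rfl, rfl⟩ := (rt_inj h hab.ne).1 he
    exact ⟨ha, hab, hb⟩
  · rintro ⟨ha, hab, hb⟩
    exact ⟨i, j, ha, hab, hb, rfl⟩

theorem rt_mem_DeltaSinv {l i j : ℕ} {s : Equiv.Perm ℕ} (h : i ≠ j) :
    rt i j ∈ DeltaSinv l s ↔
      (1 ≤ i ∧ i < j ∧ j ≤ l + 1) ∧ 1 ≤ s⁻¹ j ∧ s⁻¹ j < s⁻¹ i ∧ s⁻¹ i ≤ l + 1 := by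
  have h' : s⁻¹ j ≠ s⁻¹ i := fun e => h (s⁻¹.injective e.symm)
  simp only [DeltaSinv, DeltaNeg, Set.mem_ofPred_eq, pact_rt, neg_rt,
    rt_mem_DeltaPos h, rt_mem_DeltaPos h']

theorem rt_mem_DeltaKpos {l i j : ℕ} {s : Equiv.Perm ℕ} (h : i ≠ j) :
    rt i j ∈ DeltaKpos l s ↔ (1 ≤ i ∧ i < j ∧ j ≤ l + 1) ∧ ¬(s i = i ∧ s j = j) := by
  have h' : s i ≠ s j := s.injective.ne h
  simp only [DeltaKpos, Set.mem_ofPred_eq, pact_rt, rt_mem_DeltaPos h, ne_eq, rt_inj h' h]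

theorem rt_mem_DeltaC {l i j : ℕ} {s : Equiv.Perm ℕ} (h : i ≠ j) :
    rt i j ∈ DeltaC l s ↔ (1 ≤ i ∧ i < j ∧ j ≤ l + 1) ∧ s i = i ∧ s j ≠ j := by
  have h' : s i ≠ s j := s.injective.ne h
  simp only [DeltaC, Set.mem_ofPred_eq, pact_rt, rt_mem_DeltaKpos h, rowOf_rt h, rowOf_rt h']
  tauto

theorem rt_mem_DeltaR {l i j : ℕ} {s : Equiv.Perm ℕ} (h : i ≠ j) :
    rt i j ∈ DeltaR l s ↔ (1 ≤ i ∧ i < j ∧ j ≤ l + 1) ∧ s i ≠ i ∧ s j = j := by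
  have h' : s i ≠ s j := s.injective.ne h
  simp only [DeltaR, Set.mem_ofPred_eq, pact_rt, rt_mem_DeltaKpos h, colOf_rt h, colOf_rt h']
  tauto

theorem rt_mem_DeltaO3 {l i j m p : ℕ} {s : Equiv.Perm ℕ} (h : 1 ≤ i ∧ i < j ∧ j ≤ l + 1)
    (hsi : s i ≠ i) (hsj : s j ≠ j) (hi : i ≤ m + 1) (hj : m + p + 2 ≤ j) :
    rt i j ∈ DeltaO3 l s m p := by
  have hij : i ≠ j := h.2.1.ne
  refine ⟨⟨(rt_mem_DeltaKpos hij).2 ⟨h, fun hs => hsi hs.1⟩, ?_⟩, ?_⟩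
  · rintro (hC | hR)
    · exact hsi ((rt_mem_DeltaC hij).1 hC).2.1
    · exact hsj ((rt_mem_DeltaR hij).1 hR).2.2
  · rintro (⟨-, h₁⟩ | ⟨-, h₂⟩)
    · rw [rowOf_rt hij] at h₁
      omega
    · rw [colOf_rt hij] at h₂
      omega

theorem rt_add_rt {i j a b c d : ℕ} (hij : i < j) (hab : a < b) (hcd : c < d)
    (h : rt i j = rt a b + rt c d) :
    (a = i ∧ b = c ∧ d = j) ∨ (c = i ∧ d = a ∧ b = j) := by
  have key (x : ℕ) : (if x = i then 1 else 0) + (if x = b then 1 else 0) +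
      (if x = d then 1 else 0) = (if x = a then 1 else 0) + (if x = c then 1 else 0) +
      (if x = j then (1 : ℤ) else 0) := by
    have := congrFun h x
    simp only [rt, evec, Pi.sub_apply, Pi.add_apply] at this
    have h' : (if x = i then 1 else 0) + (if x = b then 1 else 0) +
      (if x = d then 1 else 0) = (if x = a then 1 else 0) + (if x = c then 1 else 0) +
      (if x = j then (1 : ℝ) else 0) := by linarith
    exact_mod_cast h'
  have := key i
  have := key j
  have := key a
  have := key b
  have := key c
  have := key d
  clear h key
  grind (splits := 40)

theorem weylInvFun_lt_imp {m p n a b c : ℕ} (hm : 2 ≤ m) (ha : 1 ≤ a) (hab : a < b) (hbc : b < c)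
    (hc : c ≤ n) (h₁ : weylInvFun m p n b < weylInvFun m p n a)
    (h₂ : weylInvFun m p n c < weylInvFun m p n b) :
    a = m ∧ (m + 1 < b ∧ b < m + p + 2) ∧ c = m + p + 3 := by
  have left : b ≤ m + 1 → b % 2 = m % 2 → False := by unfold weylInvFun at *; grind
  have left' : b ≤ m + 1 → b % 2 ≠ m % 2 → False := by unfold weylInvFun at *; grind
  have right : m + p + 2 ≤ b → (b - p) % 2 = m % 2 → False := by unfold weylInvFun at *; grind
  have right' : m + p + 2 ≤ b → (b - p) % 2 ≠ m % 2 → False := by unfold weylInvFun at *; grind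
  have hb : m + 1 < b ∧ b < m + p + 2 := by grind
  have hTb : weylInvFun m p n b = b := by unfold weylInvFun; grind
  rw [hTb] at h₁ h₂
  refine ⟨?_, hb, ?_⟩
  · unfold weylInvFun at h₁; grind
  · unfold weylInvFun at h₂; grind

/-- Position on the path `1, …, m + 1, m + p + 2, …, n` of the points moved by `weylS`. -/
def pathPos (m p x : ℕ) : ℕ := if x ≤ m + 1 then x else x - p

/-- The pairs `(x, y)` for which `e_x - e_y` lies in the orbit of `e_m - e_(m + p + 3)`. -/
def OrbitPair (m p n x y : ℕ) : Prop :=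
  ((1 ≤ x ∧ x ≤ m + 1) ∨ (m + p + 2 ≤ x ∧ x ≤ n)) ∧
  ((1 ≤ y ∧ y ≤ m + 1) ∨ (m + p + 2 ≤ y ∧ y ≤ n)) ∧
  if n = 2 * m + p + 2 then pathPos m p x + pathPos m p y = 2 * m + 3
  else
    (pathPos m p x % 2 = m % 2 ∧ pathPos m p x + pathPos m p y = 2 * m + 3) ∨
    (pathPos m p x % 2 ≠ m % 2 ∧ pathPos m p x + pathPos m p y = 2 * m + 5) ∨
    (m % 2 = 0 ∧ pathPos m p x = 1 ∧ pathPos m p y = 2 * m + 3) ∨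
    (m % 2 = 1 ∧ pathPos m p x = 2 * m + 3 ∧ pathPos m p y = 1)

theorem OrbitPair.weylFun {m p n x y : ℕ} (hm : 2 ≤ m)
    (hn : n = 2 * m + p + 2 ∨ n = 2 * m + p + 3) (h : OrbitPair m p n x y) :
    OrbitPair m p n (weylFun m p n x) (weylFun m p n y) := by
  obtain ⟨hx, hy, h⟩ := h
  unfold OrbitPair
  refine ⟨?_, ?_, ?_⟩
  · unfold DPW.weylFun; grind
  · unfold DPW.weylFun; grind
  · unfold pathPos at *
    rcases hx with hx | hx <;> rcases hy with hy | hy <;> rcases hn with hn | hn <;>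
      unfold DPW.weylFun <;> grind (splits := 30)

theorem OrbitPair.weylInvFun {m p n x y : ℕ} (hm : 2 ≤ m)
    (hn : n = 2 * m + p + 2 ∨ n = 2 * m + p + 3) (h : OrbitPair m p n x y) :
    OrbitPair m p n (weylInvFun m p n x) (weylInvFun m p n y) := by
  obtain ⟨hx, hy, h⟩ := h
  unfold OrbitPair
  refine ⟨?_, ?_, ?_⟩
  · unfold DPW.weylInvFun; grind
  · unfold DPW.weylInvFun; grind
  · unfold pathPos at *
    rcases hx with hx | hx <;> rcases hy with hy | hy <;> rcases hn with hn | hn <;>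
      unfold DPW.weylInvFun <;> grind (splits := 30)

theorem OrbitPair.straddle {m p n x y : ℕ}
    (hn : n = 2 * m + p + 2 ∨ n = 2 * m + p + 3) (h : OrbitPair m p n x y) (hxy : x < y) :
    x ≤ m + 1 ∧ m + p + 2 ≤ y := by
  unfold OrbitPair pathPos at h
  grind

theorem weylFun_ne {m p n x : ℕ} (hm : 2 ≤ m)
    (hn : n = 2 * m + p + 2 ∨ n = 2 * m + p + 3)
    (h : (1 ≤ x ∧ x ≤ m + 1) ∨ (m + p + 2 ≤ x ∧ x ≤ n)) : weylFun m p n x ≠ x := by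
  unfold weylFun
  grind

theorem weylFun_eq {m p n x : ℕ} (h : m + 1 < x ∧ x < m + p + 2) : weylFun m p n x = x := by
  simp [weylFun, h]

theorem OrbitPair.zpow {l l' m p : ℕ} (h5 : 5 ≤ l') (hll : l' ≤ l)
    (hm : m = (l' - 1) / 2) (hp : p = l - l') (n : ℤ) {x y : ℕ}
    (h : OrbitPair m p (l + 1) x y) :
    OrbitPair m p (l + 1) ((weylS l l' ^ n) x) ((weylS l l' ^ n) y) := by
  have hm2 : 2 ≤ m := by omega
  have hn : l + 1 = 2 * m + p + 2 ∨ l + 1 = 2 * m + p + 3 := by omega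
  induction n using Int.induction_on with
  | zero => simpa using h
  | succ k ih =>
    rw [add_comm (k : ℤ), zpow_one_add]
    simpa only [Equiv.Perm.mul_apply, weylS_apply h5 hll hm hp] using ih.weylFun hm2 hn
  | pred k ih =>
    rw [sub_eq_neg_add, zpow_add, zpow_neg_one]
    simpa only [Equiv.Perm.mul_apply, weylS_inv_apply h5 hll hm hp] using ih.weylInvFun hm2 hn

/-- Decompositions of a root of `Δ_{s⁻¹}` within `Δ_{s⁻¹}`. -/
theorem DeltaSinv_add {l l' m p : ℕ} (h5 : 5 ≤ l') (hll : l' ≤ l)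
    (hm : m = (l' - 1) / 2) (hp : p = l - l') {α η₁ η₂ : V}
    (hα : α ∈ DeltaSinv l (weylS l l')) (h₁ : η₁ ∈ DeltaSinv l (weylS l l'))
    (h₂ : η₂ ∈ DeltaSinv l (weylS l l')) (h : α = η₁ + η₂) :
    α = rt m (m + p + 3) ∧ ∃ z, (m + 1 < z ∧ z < m + p + 2) ∧
      ((η₁ = rt m z ∧ η₂ = rt z (m + p + 3)) ∨ (η₁ = rt z (m + p + 3) ∧ η₂ = rt m z)) := by
  obtain ⟨i, j, -, hij, -, rfl⟩ := hα.1
  obtain ⟨a, b, -, hab, -, rfl⟩ := h₁.1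
  obtain ⟨c, d, -, hcd, -, rfl⟩ := h₂.1
  rw [rt_mem_DeltaSinv hab.ne] at h₁
  rw [rt_mem_DeltaSinv hcd.ne] at h₂
  simp only [weylS_inv_apply h5 hll hm hp] at h₁ h₂
  have hm2 : 2 ≤ m := by omega
  have hn : l + 1 = 2 * m + p + 2 ∨ l + 1 = 2 * m + p + 3 := by omega
  obtain ⟨rfl, rfl, rfl⟩ | ⟨rfl, rfl, rfl⟩ := rt_add_rt hij hab hcd h
  · obtain ⟨rfl, hz, rfl⟩ := weylInvFun_lt_imp hm2 h₁.1.1 hab hcd h₂.1.2.2 h₁.2.2.1 h₂.2.2.1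
    exact ⟨rfl, b, hz, .inl ⟨rfl, rfl⟩⟩
  · obtain ⟨rfl, hz, rfl⟩ := weylInvFun_lt_imp hm2 h₂.1.1 hcd hab h₁.1.2.2 h₂.2.2.1 h₁.2.2.1
    exact ⟨rfl, d, hz, .inr ⟨rfl, rfl⟩⟩

/-- (a) γ′ ∈ Δ_{s⁻¹}; (b) γ′ is the only root of Δ_{s⁻¹} which is a sum of
two roots of Δ_{s⁻¹}; (c) in any such decomposition one summand is in Δ^C and the other
in Δ^R; (d) O_{γ′} ∩ (Δ̄_K)₊ ⊆ Δ₃^O. -/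
theorem stmt7 (l l' m p : ℕ) (h5 : 5 ≤ l') (hll : l' ≤ l)
    (hm : m = (l' - 1) / 2) (hp : p = l - l') :
    let s := weylS l l'
    let γ' := rt m (m + p + 3)
    γ' ∈ DeltaSinv l s ∧
      (∀ α η₁ η₂, α ∈ DeltaSinv l s → η₁ ∈ DeltaSinv l s → η₂ ∈ DeltaSinv l s →
        α = η₁ + η₂ → α = γ') ∧
      (∀ η₁ η₂, η₁ ∈ DeltaSinv l s → η₂ ∈ DeltaSinv l s → γ' = η₁ + η₂ →
        (η₁ ∈ DeltaC l s ∧ η₂ ∈ DeltaR l s) ∨ (η₁ ∈ DeltaR l s ∧ η₂ ∈ DeltaC l s)) ∧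
      orbitOf s γ' ∩ DeltaKpos l s ⊆ DeltaO3 l s m p := by
  intro s γ'
  have hm2 : 2 ≤ m := by omega
  have hn : l + 1 = 2 * m + p + 2 ∨ l + 1 = 2 * m + p + 3 := by omega
  have hne : m ≠ m + p + 3 := by omega
  have hγ : γ' ∈ DeltaSinv l s := by
    rw [rt_mem_DeltaSinv hne]
    simp only [s, weylS_inv_apply h5 hll hm hp]
    unfold weylInvFun
    grind
  refine ⟨hγ, fun α η₁ η₂ hα h₁ h₂ h => (DeltaSinv_add h5 hll hm hp hα h₁ h₂ h).1, ?_, ?_⟩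
  · intro η₁ η₂ h₁ h₂ h
    obtain ⟨-, z, hz, hη⟩ := DeltaSinv_add h5 hll hm hp hγ h₁ h₂ h
    have hsz : s z = z := by rw [weylS_apply h5 hll hm hp, weylFun_eq hz]
    have hR : rt m z ∈ DeltaR l s := by
      refine (rt_mem_DeltaR (by omega)).2 ⟨by omega, ?_, hsz⟩
      rw [weylS_apply h5 hll hm hp]
      exact weylFun_ne hm2 hn (by omega)
    have hC : rt z (m + p + 3) ∈ DeltaC l s := by
      refine (rt_mem_DeltaC (by omega)).2 ⟨by omega, hsz, ?_⟩
      rw [weylS_apply h5 hll hm hp]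
      exact weylFun_ne hm2 hn (by omega)
    obtain ⟨rfl, rfl⟩ | ⟨rfl, rfl⟩ := hη
    exacts [.inr ⟨hR, hC⟩, .inl ⟨hC, hR⟩]
  · rintro _ ⟨⟨n, rfl⟩, hK⟩
    have hO : OrbitPair m p (l + 1) m (m + p + 3) := by
      unfold OrbitPair pathPos
      grind
    have hO' := hO.zpow h5 hll hm hp n
    rw [pact_rt] at hK ⊢
    have hne' : (s ^ n) m ≠ (s ^ n) (m + p + 3) := (s ^ n).injective.ne hne
    rw [rt_mem_DeltaKpos hne'] at hK
    have hst := hO'.straddle hn hK.1.2.1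
    refine rt_mem_DeltaO3 hK.1 ?_ ?_ hst.1 hst.2 <;>
      rw [weylS_apply h5 hll hm hp]
    exacts [weylFun_ne hm2 hn hO'.1, weylFun_ne hm2 hn hO'.2.1]
end DPW
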